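/- arXiv:1312.0453 — 6 statements merged into one kernel-verified Lean document; each statement's English description precedes it below -/
import Mathlib

section
/- Let k be a field with algebraic closure k̄, let 𝔞 ⊆ k[x₁,…,xₙ,u₁,…,uₘ] be a zero-dimensional ideal, and let σ = (c₁,…,cₘ) ∈ k̄^m be a specialization. Then the ideal σ(𝔞) of k̄[x₁,…,xₙ] is zero-dimensional, i.e. k̄[x₁,…,xₙ]/σ(𝔞) is finite-dimensional over k̄. -/
open MvPolynomial

/-- The specialization `σ = (c₁,…,cₘ) ∈ K^m`: the `k`-algebra homomorphism
`k[x₁,…,xₙ,u₁,…,uₘ] → K[x₁,…,xₙ]` sending `xᵢ ↦ xᵢ` and `uⱼ ↦ cⱼ`. -/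
noncomputable def specialize (k K : Type*) [Field k] [Field K] [Algebra k K]
    (n m : ℕ) (σ : Fin m → K) :
    MvPolynomial (Fin n ⊕ Fin m) k →+* MvPolynomial (Fin n) K :=
  (aeval (Sum.elim X (fun j => C (σ j)))).toRingHom

/-- A quotient of a polynomial ring in finitely many variables is a finite module as soon as the
class of every variable is integral over the base ring. -/
theorem MvPolynomial.finite_quotient_of_isIntegral_X {ι R : Type*} [Finite ι] [CommRing R]
    (I : Ideal (MvPolynomial ι R))
    (hX : ∀ i, IsIntegral R (Ideal.Quotient.mk I (X i))) :
    Module.Finite R (MvPolynomial ι R ⧸ I) := by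
  have hadjoin : Algebra.adjoin R (Set.range fun i => Ideal.Quotient.mk I (X i)) = ⊤ := by
    have hrange : (Set.range fun i => Ideal.Quotient.mk I (X i)) =
        Ideal.Quotient.mkₐ R I '' Set.range X := by
      rw [← Set.range_comp]
      rfl
    rw [hrange, ← AlgHom.map_adjoin, adjoin_range_X, Algebra.map_top, AlgHom.range_eq_top]
    exact Ideal.Quotient.mkₐ_surjective R I
  refine ⟨?_⟩
  rw [← Algebra.top_toSubmodule, ← hadjoin]
  exact fg_adjoin_of_finite (Set.finite_range _) (Set.forall_mem_range.2 hX)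

/-- if `𝔞 ⊆ k[x₁,…,xₙ,u₁,…,uₘ]` is zero-dimensional and `σ ∈ k̄^m` is a
specialization, then the ideal `σ(𝔞)` of `k̄[x₁,…,xₙ]` is zero-dimensional, i.e.
`k̄[x₁,…,xₙ]/σ(𝔞)` is finite-dimensional over `k̄`. -/
theorem specialization_of_zeroDimensional_is_zeroDimensional
    {n m : ℕ} (k K : Type*) [Field k] [Field K] [Algebra k K] [IsAlgClosure k K]
    (𝔞 : Ideal (MvPolynomial (Fin n ⊕ Fin m) k))
    (h0 : FiniteDimensional k (MvPolynomial (Fin n ⊕ Fin m) k ⧸ 𝔞))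
    (σ : Fin m → K) :
    FiniteDimensional K
      (MvPolynomial (Fin n) K ⧸ Ideal.map (specialize k K n m σ) 𝔞) := by
  refine MvPolynomial.finite_quotient_of_isIntegral_X _ fun i => ?_
  let φ : (MvPolynomial (Fin n ⊕ Fin m) k ⧸ 𝔞) →ₐ[k]
      (MvPolynomial (Fin n) K ⧸ Ideal.map (specialize k K n m σ) 𝔞) :=
    Ideal.quotientMapₐ (Ideal.map (specialize k K n m σ) 𝔞)
      (aeval (Sum.elim X (fun j => C (σ j)))) Ideal.le_comap_map
  have hφ : φ (Ideal.Quotient.mk 𝔞 (X (Sum.inl i))) =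
      Ideal.Quotient.mk (Ideal.map (specialize k K n m σ) 𝔞) (X i) :=
    congrArg (Ideal.Quotient.mk _) (aeval_X _ _)
  rw [← hφ]
  exact ((Algebra.IsIntegral.isIntegral (R := k) _).map φ).tower_top
end

section
/- Let k be a field with algebraic closure k̄ and let 𝔞 ⊆ k[x₁,…,xₙ,u₁,…,uₘ] be a zero-dimensional ideal. For every specialization σ ∈ k̄^m there exist an order ideal O ⊆ T^n and a finite set B ⊆ 𝔞 such that the image σ(B) = {σ(b) : b ∈ B} is a scalar O-border basis of the ideal σ(𝔞) ⊆ k̄[x₁,…,xₙ]. -/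
open MvPolynomial

/-- An order ideal: a finite set of monomials (exponent vectors) closed under divisibility. -/
def IsOrderIdeal {n : ℕ} (O : Set (Fin n →₀ ℕ)) : Prop :=
  O.Finite ∧ ∀ β ∈ O, ∀ α : Fin n →₀ ℕ, α ≤ β → α ∈ O

/-- The border `∂O = (x₁O ∪ … ∪ xₙO) \ O`, with the convention `∂∅ = {1}`. -/
def border {n : ℕ} (O : Set (Fin n →₀ ℕ)) : Set (Fin n →₀ ℕ) :=
  {β | (O = ∅ ∧ β = 0) ∨
    (O ≠ ∅ ∧ β ∉ O ∧ ∃ i : Fin n, ∃ α ∈ O, β = α + Finsupp.single i 1)}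

/-- `g` assigns to each border monomial `b ∈ ∂O` a polynomial `g b = b − Σᵢ cᵢ tᵢ`
(`tᵢ ∈ O`); the family `{g b : b ∈ ∂O}` is the `O`-border basis of `I` when all
`g b ∈ I` and the residue classes of the elements of `O` form an `F`-vector space basis
of the quotient by `I`. -/
def IsBorderBasisFun {n : ℕ} (F : Type*) [Field F] (O : Set (Fin n →₀ ℕ))
    (I : Ideal (MvPolynomial (Fin n) F))
    (g : (Fin n →₀ ℕ) → MvPolynomial (Fin n) F) : Prop :=
  (∀ b ∈ border O, ↑(g b - monomial b (1 : F)).support ⊆ O ∧ g b ∈ I) ∧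
  LinearIndependent F
    (fun t : O => Ideal.Quotient.mk I (monomial (t : Fin n →₀ ℕ) (1 : F))) ∧
  Submodule.span F
    (Set.range fun t : O => Ideal.Quotient.mk I (monomial (t : Fin n →₀ ℕ) (1 : F))) = ⊤

/-- `B` is the `O`-border basis of `I`. -/
def IsBorderBasis {n : ℕ} (F : Type*) [Field F] (O : Set (Fin n →₀ ℕ))
    (I : Ideal (MvPolynomial (Fin n) F)) (B : Set (MvPolynomial (Fin n) F)) : Prop :=
  ∃ g, IsBorderBasisFun F O I g ∧ B = g '' border O

/-- `B'` is a scalar `O`-border basis of `I`: `B' = {c_b • g b : b ∈ ∂O}` with all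
`c_b ≠ 0` and `{g b : b ∈ ∂O}` the `O`-border basis of `I`. -/
def IsScalarBorderBasis {n : ℕ} (F : Type*) [Field F] (O : Set (Fin n →₀ ℕ))
    (I : Ideal (MvPolynomial (Fin n) F)) (B' : Set (MvPolynomial (Fin n) F)) : Prop :=
  ∃ (g : (Fin n →₀ ℕ) → MvPolynomial (Fin n) F) (c : (Fin n →₀ ℕ) → F),
    IsBorderBasisFun F O I g ∧ (∀ b ∈ border O, c b ≠ 0) ∧
    B' = (fun b => c b • g b) '' border O

section WellOrdered

variable {F V ι : Type*} [Field F] [AddCommGroup V] [Module F V] [LinearOrder ι]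

variable (F) in
/-- The indices of those members of a family that are not linear combinations of the members
with smaller index. -/
def nonredundant (v : ι → V) : Set ι :=
  {i | v i ∉ Submodule.span F (v '' Set.Iio i)}

theorem linearIndepOn_nonredundant (v : ι → V) : LinearIndepOn F v (nonredundant F v) := by
  rw [linearIndepOn_iff]
  intro l hl h
  by_contra hne
  have hs : l.support.Nonempty := Finsupp.support_nonempty_iff.2 hne
  set j := l.support.max' hs
  have hj : j ∈ l.support := l.support.max'_mem hs
  have hlj : l j ≠ 0 := Finsupp.mem_support_iff.1 hj
  refine hl hj ?_
  have hsplit : l j • v j + Finsupp.linearCombination F v (l.erase j) = 0 := by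
    rw [← h]
    conv_rhs => rw [← Finsupp.single_add_erase j l]
    simp
  have hmem : Finsupp.linearCombination F v (l.erase j) ∈ Submodule.span F (v '' Set.Iio j) := by
    rw [Finsupp.mem_span_image_iff_linearCombination]
    refine ⟨l.erase j, fun i hi => ?_, rfl⟩
    rw [Finsupp.support_erase] at hi
    exact lt_of_le_of_ne (l.support.le_max' i (Finset.mem_of_mem_erase hi))
      (Finset.ne_of_mem_erase hi)
  rw [← Submodule.smul_mem_iff _ hlj, eq_neg_of_add_eq_zero_left hsplit]
  exact Submodule.neg_mem _ hmem

theorem mem_span_nonredundant [WellFoundedLT ι] (v : ι → V) (i : ι) :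
    v i ∈ Submodule.span F (v '' nonredundant F v) := by
  induction i using WellFoundedLT.induction with
  | ind i ih =>
    by_cases hi : i ∈ nonredundant F v
    · exact Submodule.subset_span ⟨i, hi, rfl⟩
    · have h : v i ∈ Submodule.span F (v '' Set.Iio i) := not_not.1 hi
      refine Submodule.span_le.2 ?_ h
      rintro _ ⟨j, hj, rfl⟩
      exact ih j hj

end WellOrdered

section Standard

variable {F τ : Type*} [Field F]

/-- The monomials that modulo `I` are not linear combinations of smaller monomials. -/
def standardMonomials (m : MonomialOrder τ) (I : Ideal (MvPolynomial τ F)) : Set (τ →₀ ℕ) :=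
  m.toSyn ⁻¹' nonredundant F fun s => Ideal.Quotient.mk I (monomial (m.toSyn.symm s) (1 : F))

theorem mem_standardMonomials_of_le (m : MonomialOrder τ) {I : Ideal (MvPolynomial τ F)}
    {a b : τ →₀ ℕ} (hb : b ∈ standardMonomials m I) (hab : a ≤ b) :
    a ∈ standardMonomials m I := by
  obtain ⟨d, rfl⟩ := exists_add_of_le hab
  by_contra ha
  refine hb ?_
  have h : Ideal.Quotient.mk I (monomial a (1 : F)) ∈ Submodule.span F
      ((fun s => Ideal.Quotient.mk I (monomial (m.toSyn.symm s) (1 : F))) ''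
        Set.Iio (m.toSyn a)) := by
    simpa [standardMonomials, nonredundant] using ha
  have h' := Submodule.mem_map_of_mem
    (f := LinearMap.mulRight F (Ideal.Quotient.mk I (monomial d (1 : F)))) h
  rw [LinearMap.mulRight_apply, ← map_mul, monomial_mul, one_mul, Submodule.map_span] at h'
  simp only [AddEquiv.symm_apply_apply]
  refine Submodule.span_mono ?_ h'
  rintro _ ⟨_, ⟨s, hs, rfl⟩, rfl⟩
  refine ⟨s + m.toSyn d, ?_, ?_⟩
  · simpa using hs
  · simp [← map_mul, monomial_mul]

theorem linearIndependent_standardMonomials (m : MonomialOrder τ)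
    (I : Ideal (MvPolynomial τ F)) :
    LinearIndependent F fun t : standardMonomials m I =>
      Ideal.Quotient.mk I (monomial (t : τ →₀ ℕ) (1 : F)) := by
  have h := linearIndepOn_nonredundant (F := F)
    fun s : m.syn => Ideal.Quotient.mk I (monomial (m.toSyn.symm s) (1 : F))
  have h' := LinearIndependent.comp h
    (fun t : standardMonomials m I => ⟨m.toSyn t, t.2⟩)
    fun x y hxy => Subtype.ext (m.toSyn.injective (Subtype.ext_iff.1 hxy))
  simpa [Function.comp_def] using h'

theorem mk_monomial_eq_smul (I : Ideal (MvPolynomial τ F)) (a : τ →₀ ℕ) (c : F) :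
    Ideal.Quotient.mk I (monomial a c) = c • Ideal.Quotient.mk I (monomial a (1 : F)) := by
  rw [← mul_one c, ← smul_eq_mul, ← smul_monomial, smul_eq_mul, mul_one]
  rfl

/-- A quotient of a polynomial ring is spanned by the classes of the monomials. -/
theorem span_eq_top_of_monomial_mem {I : Ideal (MvPolynomial τ F)}
    {W : Submodule F (MvPolynomial τ F ⧸ I)}
    (h : ∀ a : τ →₀ ℕ, Ideal.Quotient.mk I (monomial a (1 : F)) ∈ W) : W = ⊤ := by
  refine eq_top_iff.2 fun x _ => ?_
  obtain ⟨p, rfl⟩ := Ideal.Quotient.mk_surjective x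
  rw [p.as_sum, map_sum]
  refine Submodule.sum_mem _ fun a _ => ?_
  rw [mk_monomial_eq_smul]
  exact W.smul_mem _ (h a)

theorem span_standardMonomials (m : MonomialOrder τ) (I : Ideal (MvPolynomial τ F)) :
    Submodule.span F (Set.range fun t : standardMonomials m I =>
      Ideal.Quotient.mk I (monomial (t : τ →₀ ℕ) (1 : F))) = ⊤ := by
  refine span_eq_top_of_monomial_mem fun a => ?_
  have h := mem_span_nonredundant (F := F)
    (fun s : m.syn => Ideal.Quotient.mk I (monomial (m.toSyn.symm s) (1 : F))) (m.toSyn a)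
  simp only [AddEquiv.symm_apply_apply] at h
  refine Submodule.span_mono ?_ h
  rintro _ ⟨s, hs, rfl⟩
  exact ⟨⟨m.toSyn.symm s, by simpa [standardMonomials] using hs⟩, rfl⟩

/-- Division with remainder by an ideal whose quotient is spanned by the monomials in `O`. -/
theorem exists_support_subset_sub_mem {O : Set (τ →₀ ℕ)} {I : Ideal (MvPolynomial τ F)}
    (h : Submodule.span F (Set.range fun t : O =>
      Ideal.Quotient.mk I (monomial (t : τ →₀ ℕ) (1 : F))) = ⊤)
    (p : MvPolynomial τ F) : ∃ r : MvPolynomial τ F, ↑r.support ⊆ O ∧ p - r ∈ I := by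
  have hp : Ideal.Quotient.mk I p ∈ Submodule.span F (Set.range fun t : O =>
      Ideal.Quotient.mk I (monomial (t : τ →₀ ℕ) (1 : F))) := h ▸ Submodule.mem_top
  obtain ⟨c, hc⟩ := (Finsupp.mem_span_range_iff_exists_finsupp).1 hp
  refine ⟨c.sum fun t a => monomial (t : τ →₀ ℕ) a, fun d hd => ?_, ?_⟩
  · classical
    obtain ⟨t, -, ht⟩ := Finset.mem_biUnion.1 (support_sum hd)
    rw [Finset.mem_singleton.1 (support_monomial_subset ht)]
    exact t.2
  · rw [← Ideal.Quotient.eq, ← hc, Finsupp.sum, Finsupp.sum, map_sum]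
    exact Finset.sum_congr rfl fun t _ => (mk_monomial_eq_smul I t (c t)).symm

end Standard

section Border

variable {n : ℕ}

theorem border_finite {O : Set (Fin n →₀ ℕ)} (hO : O.Finite) : (border O).Finite := by
  refine ((Set.finite_singleton 0).union
    (hO.image2 (fun α (i : Fin n) => α + Finsupp.single i 1) Set.finite_univ)).subset ?_
  rintro b (⟨-, rfl⟩ | ⟨-, -, i, α, hα, rfl⟩)
  · exact Or.inl rfl
  · exact Or.inr ⟨α, hα, i, trivial, rfl⟩

/-- Every zero-dimensional ideal has a border basis. -/
theorem exists_isBorderBasisFun {F : Type*} [Field F] (I : Ideal (MvPolynomial (Fin n) F))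
    [FiniteDimensional F (MvPolynomial (Fin n) F ⧸ I)] :
    ∃ O g, IsOrderIdeal O ∧ IsBorderBasisFun F O I g := by
  let O := standardMonomials (MonomialOrder.lex (σ := Fin n)) I
  have hli := linearIndependent_standardMonomials (MonomialOrder.lex (σ := Fin n)) I
  have hsp := span_standardMonomials (MonomialOrder.lex (σ := Fin n)) I
  choose r hrO hrI using fun b : Fin n →₀ ℕ =>
    exists_support_subset_sub_mem hsp (monomial b (1 : F))
  have : Finite O := hli.finite
  refine ⟨O, fun b => monomial b 1 - r b, ⟨O.toFinite, fun β hβ α h =>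
    mem_standardMonomials_of_le _ hβ h⟩, fun b _ => ⟨?_, hrI b⟩, hli, hsp⟩
  simpa using hrO b

/-- The image of a zero-dimensional ideal under a surjection onto a polynomial ring, possibly
over a larger field, has a border basis. -/
theorem exists_isBorderBasisFun_map {k F R : Type*} [Field k] [Field F] [Algebra k F]
    [CommRing R] [Algebra k R] (𝔞 : Ideal R) [FiniteDimensional k (R ⧸ 𝔞)]
    (s : R →ₐ[k] MvPolynomial (Fin n) F) (hs : Function.Surjective s) :
    ∃ O g, IsOrderIdeal O ∧ IsBorderBasisFun F O (𝔞.map s) g := by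
  have : Module.Finite k (MvPolynomial (Fin n) F ⧸ 𝔞.map s) :=
    Module.Finite.of_surjective (Ideal.quotientMapₐ (𝔞.map s) s Ideal.le_comap_map).toLinearMap
      (Ideal.quotientMap_surjective (H := Ideal.le_comap_map) hs)
  have : FiniteDimensional F (MvPolynomial (Fin n) F ⧸ 𝔞.map s) :=
    Module.Finite.of_restrictScalars_finite k F _
  exact exists_isBorderBasisFun _

end Border

section BaseChange

variable {F K τ : Type*} [Field F] [Field K] [Algebra F K]

/-- Applying an `F`-linear functional of `K` to the coefficients maps the extension of an ideal
of `F[X]` to `K[X]` into the ideal. -/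
theorem exists_mem_coeff_eq_of_mem_map {J : Ideal (MvPolynomial τ F)} {p : MvPolynomial τ K}
    (hp : p ∈ J.map (MvPolynomial.map (algebraMap F K))) (φ : K →ₗ[F] F) :
    ∃ q ∈ J, ∀ a, coeff a q = φ (coeff a p) := by
  classical
  induction hp using Submodule.span_induction generalizing φ with
  | mem p hp =>
    obtain ⟨q, hq, rfl⟩ := hp
    refine ⟨C (φ 1) * q, J.mul_mem_left _ hq, fun a => ?_⟩
    rw [coeff_C_mul, coeff_map, Algebra.algebraMap_eq_smul_one, map_smul, smul_eq_mul, mul_comm]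
  | zero => exact ⟨0, J.zero_mem, by simp⟩
  | add p p' _ _ ih ih' =>
    obtain ⟨q, hq, h⟩ := ih φ
    obtain ⟨q', hq', h'⟩ := ih' φ
    exact ⟨q + q', J.add_mem hq hq', by simp [h, h']⟩
  | smul r p _ ih =>
    rw [smul_eq_mul]
    induction r using MvPolynomial.induction_on generalizing φ with
    | C c =>
      obtain ⟨q, hq, h⟩ := ih (φ ∘ₗ LinearMap.mulLeft F c)
      exact ⟨q, hq, fun a => by simp [h]⟩
    | add r r' ihr ihr' =>
      obtain ⟨q, hq, h⟩ := ihr φ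
      obtain ⟨q', hq', h'⟩ := ihr' φ
      exact ⟨q + q', J.add_mem hq hq', by simp [h, h', add_mul]⟩
    | mul_X r i ihr =>
      obtain ⟨q, hq, h⟩ := ihr φ
      refine ⟨q * X i, J.mul_mem_right _ hq, fun a => ?_⟩
      rw [mul_right_comm, coeff_mul_X', coeff_mul_X']
      split_ifs
      · exact h _
      · simp

/-- Monomials that are linearly independent modulo an ideal remain so after a field extension. -/
theorem linearIndependent_monomial_map {O : Set (τ →₀ ℕ)} {J : Ideal (MvPolynomial τ F)}
    (h : LinearIndependent F fun t : O =>
      Ideal.Quotient.mk J (monomial (t : τ →₀ ℕ) (1 : F))) :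
    LinearIndependent K fun t : O =>
      Ideal.Quotient.mk (J.map (MvPolynomial.map (algebraMap F K)))
        (monomial (t : τ →₀ ℕ) (1 : K)) := by
  classical
  rw [linearIndependent_iff'] at h ⊢
  intro s c hc i hi
  have hmem : ∑ t ∈ s, monomial (t : τ →₀ ℕ) (c t) ∈
      J.map (MvPolynomial.map (algebraMap F K)) := by
    rw [← Ideal.Quotient.eq_zero_iff_mem, ← hc, map_sum]
    exact Finset.sum_congr rfl fun t _ => mk_monomial_eq_smul _ _ _
  rw [← Module.forall_dual_apply_eq_zero_iff F]
  intro φ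
  obtain ⟨q, hq, hqc⟩ := exists_mem_coeff_eq_of_mem_map hmem φ
  refine h s (fun t => φ (c t)) ?_ i hi
  have hqs : q = ∑ t ∈ s, monomial (t : τ →₀ ℕ) (φ (c t)) := by
    ext a
    rw [hqc, coeff_sum, coeff_sum, map_sum]
    refine Finset.sum_congr rfl fun t _ => ?_
    rw [coeff_monomial, coeff_monomial, apply_ite φ, map_zero]
  rw [← Ideal.Quotient.eq_zero_iff_mem.2 hq, hqs, map_sum]
  exact Finset.sum_congr rfl fun t _ => (mk_monomial_eq_smul _ _ _).symm

/-- Monomials that span modulo an ideal still do so after a field extension. -/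
theorem span_monomial_map {O : Set (τ →₀ ℕ)} {J : Ideal (MvPolynomial τ F)}
    (h : Submodule.span F (Set.range fun t : O =>
      Ideal.Quotient.mk J (monomial (t : τ →₀ ℕ) (1 : F))) = ⊤) :
    Submodule.span K (Set.range fun t : O =>
      Ideal.Quotient.mk (J.map (MvPolynomial.map (algebraMap F K)))
        (monomial (t : τ →₀ ℕ) (1 : K))) = ⊤ := by
  refine span_eq_top_of_monomial_mem fun a => ?_
  obtain ⟨r, hr, hrJ⟩ := exists_support_subset_sub_mem h (monomial a (1 : F))
  have hmk := Ideal.Quotient.eq.2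
    (map_sub (MvPolynomial.map (algebraMap F K)) (monomial a 1) r ▸
      Ideal.mem_map_of_mem (MvPolynomial.map (algebraMap F K)) hrJ)
  rw [map_monomial, map_one] at hmk
  rw [hmk, r.as_sum, map_sum, map_sum]
  refine Submodule.sum_mem _ fun b hb => ?_
  rw [map_monomial, mk_monomial_eq_smul]
  exact Submodule.smul_mem _ _ (Submodule.subset_span ⟨⟨b, hr hb⟩, rfl⟩)

/-- Border bases are preserved by field extensions. -/
theorem IsBorderBasisFun.map {n : ℕ} {O : Set (Fin n →₀ ℕ)} {J : Ideal (MvPolynomial (Fin n) F)}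
    {g : (Fin n →₀ ℕ) → MvPolynomial (Fin n) F} (h : IsBorderBasisFun F O J g) :
    IsBorderBasisFun K O (J.map (MvPolynomial.map (algebraMap F K)))
      fun b => MvPolynomial.map (algebraMap F K) (g b) := by
  refine ⟨fun b hb => ⟨fun a ha => (h.1 b hb).1 ?_, Ideal.mem_map_of_mem _ (h.1 b hb).2⟩,
    linearIndependent_monomial_map h.2.1, span_monomial_map h.2.2⟩
  refine support_map_subset (algebraMap F K) (g b - monomial b 1) ?_
  simpa using ha

end BaseChange

section Specialization

open IntermediateField

variable (k : Type*) {K : Type*} [Field k] [Field K] [Algebra k K] (n : ℕ) {m : ℕ}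

/-- The specialization at `σ` with coefficients restricted to the field generated by `σ`. -/
noncomputable def specializeAdjoin (σ : Fin m → K) :
    MvPolynomial (Fin n ⊕ Fin m) k →ₐ[k] MvPolynomial (Fin n) (adjoin k (Set.range σ)) :=
  aeval (Sum.elim X fun j => C ⟨σ j, subset_adjoin k _ ⟨j, rfl⟩⟩)

theorem specialize_eq_map_comp (σ : Fin m → K) :
    specialize k K n m σ =
      (MvPolynomial.map (algebraMap (adjoin k (Set.range σ)) K)).comp
        (specializeAdjoin k n σ).toRingHom := by
  refine MvPolynomial.ringHom_ext (fun c => ?_) fun i => ?_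
  · simp [specialize, specializeAdjoin, IntermediateField.algebraMap_apply,
      MvPolynomial.algebraMap_apply]
  · rcases i with i | j <;> simp [specialize, specializeAdjoin]

theorem specializeAdjoin_surjective [Algebra.IsAlgebraic k K] (σ : Fin m → K) :
    Function.Surjective (specializeAdjoin k n σ) := by
  rw [← AlgHom.range_eq_top, eq_top_iff]
  have hC : ∀ (a : K) (ha : a ∈ adjoin k (Set.range σ)),
      (C ⟨a, ha⟩ : MvPolynomial (Fin n) (adjoin k (Set.range σ))) ∈
        (specializeAdjoin k n σ).range := by
    intro a ha
    have ha' : a ∈ Algebra.adjoin k (Set.range σ) := by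
      rwa [← adjoin_toSubalgebra_of_isAlgebraic
        (fun x _ => Algebra.IsAlgebraic.isAlgebraic x)]
    let ψ : MvPolynomial (Fin m) k →ₐ[k] adjoin k (Set.range σ) :=
      aeval fun j => ⟨σ j, subset_adjoin k _ ⟨j, rfl⟩⟩
    rw [Algebra.adjoin_range_eq_range_aeval] at ha'
    obtain ⟨p, hp⟩ := ha'
    replace hp : aeval σ p = a := hp
    refine ⟨rename Sum.inr p, ?_⟩
    have hψ : ψ p = ⟨a, ha⟩ := by
      apply Subtype.ext
      change (adjoin k (Set.range σ)).val (ψ p) = _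
      rw [comp_aeval_apply]
      exact hp
    rw [← hψ]
    change specializeAdjoin k n σ (rename Sum.inr p) =
      IsScalarTower.toAlgHom k (adjoin k (Set.range σ)) (MvPolynomial (Fin n) _) (ψ p)
    rw [comp_aeval_apply, specializeAdjoin, aeval_rename]
    rfl
  intro p _
  induction p using MvPolynomial.induction_on with
  | C a => exact hC a a.2
  | add p q hp hq => exact add_mem (hp trivial) (hq trivial)
  | mul_X p i hp => exact mul_mem (hp trivial) ⟨X (Sum.inl i), by simp [specializeAdjoin]⟩

end Specialization

/-- let `𝔞 ⊆ k[x₁,…,xₙ,u₁,…,uₘ]` be a zero-dimensional ideal.  For every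
specialization `σ ∈ k̄^m` there exist an order ideal `O ⊆ T^n` and a finite set
`B ⊆ 𝔞` such that `σ(B)` is a scalar `O`-border basis of `σ(𝔞) ⊆ k̄[x₁,…,xₙ]`. -/
theorem exists_conditional_scalar_border_basis
    {n m : ℕ} (k K : Type*) [Field k] [Field K] [Algebra k K] [IsAlgClosure k K]
    (𝔞 : Ideal (MvPolynomial (Fin n ⊕ Fin m) k))
    (h0 : FiniteDimensional k (MvPolynomial (Fin n ⊕ Fin m) k ⧸ 𝔞))
    (σ : Fin m → K) :
    ∃ (O : Set (Fin n →₀ ℕ)) (B : Set (MvPolynomial (Fin n ⊕ Fin m) k)),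
      IsOrderIdeal O ∧ B.Finite ∧ B ⊆ (𝔞 : Set (MvPolynomial (Fin n ⊕ Fin m) k)) ∧
      IsScalarBorderBasis K O (Ideal.map (specialize k K n m σ) 𝔞)
        ((specialize k K n m σ) '' B) := by
  have : Algebra.IsAlgebraic k K := IsAlgClosure.isAlgebraic
  let F := IntermediateField.adjoin k (Set.range σ)
  let s := specializeAdjoin k n σ
  have hs : Function.Surjective s := specializeAdjoin_surjective k n σ
  let J : Ideal (MvPolynomial (Fin n) F) := 𝔞.map s
  obtain ⟨O, g, hO, hg⟩ := exists_isBorderBasisFun_map 𝔞 s hs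
  have hlift : ∀ b ∈ border O, ∃ q ∈ 𝔞, s q = g b := fun b hb =>
    (Ideal.mem_map_iff_of_surjective s hs).1 (hg.1 b hb).2
  choose! f hf𝔞 hfg using hlift
  have hJ : 𝔞.map (specialize k K n m σ) = J.map (MvPolynomial.map (algebraMap F K)) := by
    rw [specialize_eq_map_comp, ← Ideal.map_map]
    rfl
  refine ⟨O, f '' border O, hO, (border_finite hO.1).image f, Set.image_subset_iff.2 hf𝔞,
    fun b => MvPolynomial.map (algebraMap F K) (g b), 1, hJ ▸ hg.map, by simp, ?_⟩
  rw [Set.image_image]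
  refine Set.image_congr fun b hb => ?_
  rw [specialize_eq_map_comp, Pi.one_apply, one_smul]
  exact congrArg (MvPolynomial.map (algebraMap F K)) (hfg b hb)
end

section
/- Let k be a field with algebraic closure k̄ and let 𝔞 ⊆ k[x₁,…,xₙ,u₁,…,uₘ] be a zero-dimensional ideal. Then a comprehensive border basis for 𝔞 exists: there is a finite set B ⊆ 𝔞 such that for every specialization σ ∈ k̄^m there exists an order ideal O ⊆ T^n for which some subset of σ(B) = {σ(b) : b ∈ B} is a scalar O-border basis of σ(𝔞) in k̄[x₁,…,xₙ]. -/
open MvPolynomial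

/-- A family in a vector space, indexed by a type that injects into a linear order, is linearly
independent if no member lies in the span of the members with smaller index. -/
theorem linearIndependent_of_notMem_span_lt {F V ι α : Type*} [Field F] [AddCommGroup V]
    [Module F V] [LinearOrder α] (f : ι → α) (hf : Function.Injective f) (v : ι → V)
    (hv : ∀ i, v i ∉ Submodule.span F (v '' {j | f j < f i})) : LinearIndependent F v := by
  classical
  rw [linearIndependent_iff]
  intro l hl
  by_contra hne
  obtain ⟨i, hi, hmax⟩ := l.support.exists_max_image f (Finsupp.support_nonempty_iff.mpr hne)
  apply hv i
  have hsum : l i • v i = -∑ j ∈ l.support.erase i, l j • v j := by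
    rw [Finsupp.linearCombination_apply, Finsupp.sum, ← Finset.add_sum_erase _ _ hi] at hl
    exact eq_neg_of_add_eq_zero_left hl
  rw [← Submodule.smul_mem_iff _ (Finsupp.mem_support_iff.mp hi), hsum]
  refine neg_mem (sum_mem fun j hj => Submodule.smul_mem _ _ (Submodule.subset_span ⟨j, ?_, rfl⟩))
  obtain ⟨hji, hj⟩ := Finset.mem_erase.mp hj
  exact lt_of_le_of_ne (hmax j hj) fun h => hji (hf h)

/-- The standard monomials of an ideal with respect to the lexicographic order: a set of monomials
closed under divisibility whose residue classes form a basis of the quotient. -/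
theorem exists_isLowerSet_basis_quotient {n : ℕ} {F : Type*} [Field F]
    (I : Ideal (MvPolynomial (Fin n) F)) :
    ∃ O : Set (Fin n →₀ ℕ), IsLowerSet O ∧
      LinearIndependent F
        (fun t : O => Ideal.Quotient.mk I (monomial (t : Fin n →₀ ℕ) (1 : F))) ∧
      Submodule.span F
        (Set.range fun t : O => Ideal.Quotient.mk I (monomial (t : Fin n →₀ ℕ) (1 : F))) = ⊤ := by
  let m : MonomialOrder (Fin n) := MonomialOrder.lex
  let v : (Fin n →₀ ℕ) → MvPolynomial (Fin n) F ⧸ I :=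
    fun t => Ideal.Quotient.mk I (monomial t (1 : F))
  let below : (Fin n →₀ ℕ) → Set (Fin n →₀ ℕ) := fun t => {s | m.toSyn s < m.toSyn t}
  let O : Set (Fin n →₀ ℕ) := {t | v t ∉ Submodule.span F (v '' below t)}
  refine ⟨O, ?_, ?_, ?_⟩
  · intro β α hαβ hβ hα
    apply hβ
    obtain ⟨γ, rfl⟩ := exists_add_of_le hαβ
    have hv : ∀ t, v (t + γ) = LinearMap.mulLeft F (v γ) (v t) := fun t => by
      simp [v, ← map_mul, monomial_mul, add_comm]
    rw [hv]
    have h := Submodule.mem_map_of_mem (f := LinearMap.mulLeft F (v γ)) hα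
    rw [Submodule.map_span] at h
    refine Submodule.span_mono ?_ h
    rintro _ ⟨_, ⟨s, hs, rfl⟩, rfl⟩
    refine ⟨s + γ, ?_, hv s⟩
    simpa [below] using hs
  · refine linearIndependent_of_notMem_span_lt (fun t : O => m.toSyn t)
      (m.toSyn.injective.comp Subtype.val_injective) (fun t : O => v t) fun t ht => t.2 ?_
    refine Submodule.span_mono ?_ ht
    rintro _ ⟨s, hs, rfl⟩
    exact ⟨s, hs, rfl⟩
  · have hmem : ∀ t, v t ∈ Submodule.span F (Set.range fun t : O => v t) := by
      intro t
      induction t using (InvImage.wf m.toSyn (wellFounded_lt (α := m.syn))).induction with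
      | _ t ih =>
        by_cases ht : t ∈ O
        · exact Submodule.subset_span ⟨⟨t, ht⟩, rfl⟩
        · refine Submodule.span_le.mpr ?_ (not_not.mp ht)
          rintro _ ⟨s, hs, rfl⟩
          exact ih s hs
    rw [eq_top_iff]
    rintro x -
    obtain ⟨p, rfl⟩ := Ideal.Quotient.mk_surjective x
    induction p using MvPolynomial.induction_on' with
    | monomial t a =>
      have h : Ideal.Quotient.mk I (monomial t a) = a • v t := by
        rw [← Ideal.Quotient.mkₐ_eq_mk F, ← mul_one a, ← smul_eq_mul, map_smul, map_smul,
          smul_eq_mul, mul_one]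
        rfl
      rw [h]
      exact Submodule.smul_mem _ _ (hmem t)
    | add p q hp hq => rw [map_add]; exact add_mem hp hq

/-- If all elements of an `L`-subspace `W` of `K[X]` have coefficients in `L`, then every element
of the `K`-span of `W` can be replaced by an element of `W` without changing those of its
coefficients that lie in `L`. -/
theorem exists_mem_coeff_eq_of_mem_span {k K τ : Type*} [Field k] [Field K] [Algebra k K]
    (L : IntermediateField k K) (W : Submodule L (MvPolynomial τ K))
    (hW : ∀ w ∈ W, ∀ d, coeff d w ∈ L) {p : MvPolynomial τ K}
    (hp : p ∈ Submodule.span K (W : Set (MvPolynomial τ K))) :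
    ∃ w ∈ W, ∀ d, coeff d p ∈ L → coeff d w = coeff d p := by
  obtain ⟨π, hπ⟩ := (Algebra.linearMap L K).exists_leftInverse_of_injective
    (LinearMap.ker_eq_bot.mpr (algebraMap L K).injective)
  let q : K →ₗ[L] K := (Algebra.linearMap L K).comp π
  have hq : ∀ x ∈ L, q x = x := fun x hx =>
    congrArg (algebraMap L K) (LinearMap.congr_fun hπ ⟨x, hx⟩)
  suffices h : ∃ w ∈ W, ∀ d, coeff d w = q (coeff d p) by
    obtain ⟨w, hw, h⟩ := h
    exact ⟨w, hw, fun d hd => (h d).trans (hq _ hd)⟩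
  induction hp using Submodule.closure_induction with
  | zero => exact ⟨0, zero_mem _, by simp⟩
  | add x y _ _ hx hy =>
    obtain ⟨a, ha, hxa⟩ := hx
    obtain ⟨b, hb, hyb⟩ := hy
    exact ⟨a + b, add_mem ha hb, fun d => by rw [coeff_add, coeff_add, map_add, hxa, hyb]⟩
  | smul_mem r x hx =>
    refine ⟨π r • x, W.smul_mem _ hx, fun d => ?_⟩
    have h : q (coeff d (r • x)) = (⟨coeff d x, hW x hx d⟩ : L) • q r := by
      rw [← map_smul, coeff_smul, smul_eq_mul, mul_comm]
      rfl
    rw [h, coeff_smul, Algebra.smul_def, Algebra.smul_def, mul_comm]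
    rfl

theorem specialize_X_inl {n m : ℕ} {k K : Type*} [Field k] [Field K] [Algebra k K]
    (σ : Fin m → K) (i : Fin n) : specialize k K n m σ (X (Sum.inl i)) = X i := by
  simp [specialize]

theorem specialize_rename_inr {n m : ℕ} {k K : Type*} [Field k] [Field K] [Algebra k K]
    (σ : Fin m → K) (p : MvPolynomial (Fin m) k) :
    specialize k K n m σ (rename Sum.inr p) = C (aeval σ p) := by
  have h : (aeval (Sum.elim X (fun j => C (σ j))) : _ →ₐ[k] MvPolynomial (Fin n) K).comp
      (rename Sum.inr) = (IsScalarTower.toAlgHom k K (MvPolynomial (Fin n) K)).comp (aeval σ) := by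
    ext i
    simp
  exact DFunLike.congr_fun h p

/-- The ideal generated by the specialized ideal is the `K`-span of the specialized elements. -/
theorem mem_span_of_mem_map_specialize {n m : ℕ} {k K : Type*} [Field k] [Field K] [Algebra k K]
    (σ : Fin m → K) (𝔞 : Ideal (MvPolynomial (Fin n ⊕ Fin m) k)) {p : MvPolynomial (Fin n) K}
    (hp : p ∈ Ideal.map (specialize k K n m σ) 𝔞) :
    p ∈ Submodule.span K (specialize k K n m σ '' (𝔞 : Set (MvPolynomial (Fin n ⊕ Fin m) k))) := by
  have hX : ∀ (i : Fin n), ∀ x ∈ Submodule.span K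
      (specialize k K n m σ '' (𝔞 : Set (MvPolynomial (Fin n ⊕ Fin m) k))),
      X i * x ∈ Submodule.span K
        (specialize k K n m σ '' (𝔞 : Set (MvPolynomial (Fin n ⊕ Fin m) k))) := by
    intro i x hx
    have h := Submodule.mem_map_of_mem (f := LinearMap.mulLeft K (X i : MvPolynomial (Fin n) K)) hx
    rw [Submodule.map_span] at h
    refine Submodule.span_mono ?_ h
    rintro _ ⟨_, ⟨a, ha, rfl⟩, rfl⟩
    exact ⟨X (Sum.inl i) * a, Ideal.mul_mem_left _ _ ha, by simp [specialize_X_inl]⟩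
  have hmul : ∀ f : MvPolynomial (Fin n) K, ∀ x ∈ Submodule.span K
      (specialize k K n m σ '' (𝔞 : Set (MvPolynomial (Fin n ⊕ Fin m) k))),
      f * x ∈ Submodule.span K
        (specialize k K n m σ '' (𝔞 : Set (MvPolynomial (Fin n ⊕ Fin m) k))) := by
    intro f
    induction f using MvPolynomial.induction_on with
    | C a => intro x hx; rw [← smul_eq_C_mul]; exact Submodule.smul_mem _ _ hx
    | add p q hp hq => intro x hx; rw [add_mul]; exact add_mem (hp x hx) (hq x hx)
    | mul_X p i hp => intro x hx; rw [mul_assoc]; exact hp _ (hX i x hx)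
  rw [Ideal.map] at hp
  induction hp using Submodule.span_induction with
  | mem x hx => exact Submodule.subset_span hx
  | zero => exact zero_mem _
  | add x y _ _ hx hy => exact add_mem hx hy
  | smul f x _ hx => exact hmul f x hx

theorem coeff_specialize_mem_adjoin {n m : ℕ} {k K : Type*} [Field k] [Field K] [Algebra k K]
    (σ : Fin m → K) (f : MvPolynomial (Fin n ⊕ Fin m) k) (d : Fin n →₀ ℕ) :
    coeff d (specialize k K n m σ f) ∈ IntermediateField.adjoin k (Set.range σ) := by
  let L := IntermediateField.adjoin k (Set.range σ)
  let σ' : Fin m → L := fun j => ⟨σ j, IntermediateField.subset_adjoin k _ ⟨j, rfl⟩⟩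
  have h : specialize k K n m σ =
      (MvPolynomial.map (algebraMap L K)).comp (specialize k L n m σ') := by
    refine MvPolynomial.ringHom_ext (fun r => ?_) ?_
    · simp [specialize, ← IsScalarTower.algebraMap_apply]
    · rintro (i | j)
      · simp [specialize]
      · simp [specialize, σ']
  rw [h, RingHom.comp_apply, coeff_map]
  exact SetLike.coe_mem _

/-- An element of the extended specialized ideal may be replaced by the specialization of an
element of the original ideal, keeping all coefficients that lie in the field generated by the
specialized parameters. -/
theorem exists_mem_coeff_specialize_eq {n m : ℕ} {k K : Type*} [Field k] [Field K] [Algebra k K]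
    [Algebra.IsAlgebraic k K] (σ : Fin m → K) (𝔞 : Ideal (MvPolynomial (Fin n ⊕ Fin m) k))
    {p : MvPolynomial (Fin n) K} (hp : p ∈ Ideal.map (specialize k K n m σ) 𝔞) :
    ∃ a ∈ 𝔞, ∀ d, coeff d p ∈ IntermediateField.adjoin k (Set.range σ) →
      coeff d (specialize k K n m σ a) = coeff d p := by
  let L := IntermediateField.adjoin k (Set.range σ)
  let W : Submodule L (MvPolynomial (Fin n) K) :=
    { carrier := specialize k K n m σ '' (𝔞 : Set (MvPolynomial (Fin n ⊕ Fin m) k))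
      zero_mem' := ⟨0, zero_mem _, map_zero _⟩
      add_mem' := by
        rintro _ _ ⟨a, ha, rfl⟩ ⟨b, hb, rfl⟩
        exact ⟨a + b, add_mem ha hb, map_add _ _ _⟩
      smul_mem' := by
        rintro ⟨l, hl⟩ _ ⟨a, ha, rfl⟩
        have hl' : l ∈ (IntermediateField.adjoin k (Set.range σ)).toSubalgebra := hl
        rw [IntermediateField.adjoin_toSubalgebra, Algebra.adjoin_range_eq_range_aeval] at hl'
        obtain ⟨q, rfl⟩ := hl'
        refine ⟨rename Sum.inr q * a, Ideal.mul_mem_left _ _ ha, ?_⟩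
        rw [map_mul, specialize_rename_inr, ← smul_eq_C_mul]
        rfl }
  obtain ⟨_, ⟨a, ha, rfl⟩, h⟩ := exists_mem_coeff_eq_of_mem_span L W
    (by rintro _ ⟨a, -, rfl⟩ d; exact coeff_specialize_mem_adjoin σ a d)
    (mem_span_of_mem_map_specialize σ 𝔞 hp)
  exact ⟨a, ha, h⟩

theorem finite_border {n : ℕ} {O : Set (Fin n →₀ ℕ)} (hO : O.Finite) : (border O).Finite := by
  refine ((Set.finite_singleton (0 : Fin n →₀ ℕ)).union
    (Set.finite_iUnion fun i : Fin n => hO.image fun α => α + Finsupp.single i 1)).subset ?_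
  rintro β (⟨-, rfl⟩ | ⟨-, -, i, α, hα, rfl⟩)
  · exact Or.inl rfl
  · exact Or.inr (Set.mem_iUnion.mpr ⟨i, α, hα, rfl⟩)

/-- The residue classes of monomials in a quotient by a specialized zero-dimensional ideal can
only be linearly independent if there are finitely many of them. -/
theorem finite_of_linearIndependent_monomial {n m : ℕ} {k K : Type*} [Field k] [Field K]
    [Algebra k K] (σ : Fin m → K) (𝔞 : Ideal (MvPolynomial (Fin n ⊕ Fin m) k))
    [FiniteDimensional k (MvPolynomial (Fin n ⊕ Fin m) k ⧸ 𝔞)] {O : Set (Fin n →₀ ℕ)}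
    (hO : LinearIndependent K (fun t : O => Ideal.Quotient.mk
      (Ideal.map (specialize k K n m σ) 𝔞) (monomial (t : Fin n →₀ ℕ) (1 : K)))) :
    O.Finite := by
  let φ : MvPolynomial (Fin n ⊕ Fin m) k →ₐ[k] MvPolynomial (Fin n) K :=
    aeval (Sum.elim X (fun j => C (σ j)))
  let I := Ideal.map (specialize k K n m σ) 𝔞
  let ψ : (MvPolynomial (Fin n ⊕ Fin m) k ⧸ 𝔞) →ₐ[k] (MvPolynomial (Fin n) K ⧸ I) :=
    Ideal.quotientMapₐ I φ Ideal.le_comap_map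
  have hφ : ∀ t : Fin n →₀ ℕ, φ (rename Sum.inl (monomial t (1 : k))) = monomial t (1 : K) := by
    intro t
    simp only [φ, aeval_rename, Sum.elim_comp_inl, aeval_monomial, map_one, one_mul]
    rw [monomial_eq, C_1, one_mul]
  have hlin : LinearIndependent k (fun t : O => Ideal.Quotient.mk 𝔞
      (rename Sum.inl (monomial (t : Fin n →₀ ℕ) (1 : k)))) := by
    refine LinearIndependent.of_comp ψ.toLinearMap ?_
    have h : ψ.toLinearMap ∘ (fun t : O => Ideal.Quotient.mk 𝔞
        (rename Sum.inl (monomial (t : Fin n →₀ ℕ) (1 : k)))) =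
        fun t : O => Ideal.Quotient.mk I (monomial (t : Fin n →₀ ℕ) (1 : K)) :=
      funext fun t => congrArg (Ideal.Quotient.mk I) (hφ t)
    rw [h]
    exact hO.restrict_scalars' k
  exact Set.finite_coe_iff.mp hlin.finite

/-- The contribution of a single specialization to a comprehensive border basis. -/
theorem exists_finite_isScalarBorderBasis_specialize {n m : ℕ} {k K : Type*} [Field k] [Field K]
    [Algebra k K] [Algebra.IsAlgebraic k K] (𝔞 : Ideal (MvPolynomial (Fin n ⊕ Fin m) k))
    [FiniteDimensional k (MvPolynomial (Fin n ⊕ Fin m) k ⧸ 𝔞)] (σ : Fin m → K) :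
    ∃ B : Set (MvPolynomial (Fin n ⊕ Fin m) k),
      B.Finite ∧ B ⊆ (𝔞 : Set (MvPolynomial (Fin n ⊕ Fin m) k)) ∧
      ∃ O : Set (Fin n →₀ ℕ), IsOrderIdeal O ∧
        IsScalarBorderBasis K O (Ideal.map (specialize k K n m σ) 𝔞)
          (specialize k K n m σ '' B) := by
  let I := Ideal.map (specialize k K n m σ) 𝔞
  obtain ⟨O, hlow, hlin, hspan⟩ := exists_isLowerSet_basis_quotient I
  have hfin : O.Finite := finite_of_linearIndependent_monomial σ 𝔞 hlin
  have hrep : ∀ b : Fin n →₀ ℕ, ∃ a ∈ 𝔞,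
      ↑(specialize k K n m σ a - monomial b (1 : K)).support ⊆ O := by
    intro b
    have hb : Ideal.Quotient.mk I (monomial b (1 : K)) ∈ Submodule.span K
        (Set.range fun t : O => Ideal.Quotient.mk I (monomial (t : Fin n →₀ ℕ) (1 : K))) :=
      hspan ▸ Submodule.mem_top
    obtain ⟨l, hl⟩ := Finsupp.mem_span_range_iff_exists_finsupp.mp hb
    let r : MvPolynomial (Fin n) K := l.sum fun t c => monomial (t : Fin n →₀ ℕ) c
    have hr : ∀ d ∉ O, coeff d r = 0 := by
      intro d hd
      simp only [r, Finsupp.sum, coeff_sum, coeff_monomial]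
      exact Finset.sum_eq_zero fun t _ => if_neg fun h : (t : Fin n →₀ ℕ) = d => hd (h ▸ t.2)
    have hmk : Ideal.Quotient.mk I r = Ideal.Quotient.mk I (monomial b (1 : K)) := by
      rw [← hl]
      simp only [r, Finsupp.sum, map_sum]
      refine Finset.sum_congr rfl fun t _ => ?_
      rw [← Ideal.Quotient.mkₐ_eq_mk K, ← map_smul, smul_monomial, smul_eq_mul, mul_one]
    obtain ⟨a, ha, hcoeff⟩ := exists_mem_coeff_specialize_eq σ 𝔞
      (p := monomial b (1 : K) - r) (Ideal.Quotient.eq.mp hmk.symm)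
    refine ⟨a, ha, fun d hd => ?_⟩
    by_contra hdO
    apply mem_support_iff.mp hd
    have h : coeff d (monomial b (1 : K) - r) = coeff d (monomial b (1 : K)) := by
      rw [coeff_sub, hr d hdO, sub_zero]
    rw [coeff_sub, hcoeff d, h, sub_self]
    rw [h, coeff_monomial]
    split_ifs
    exacts [one_mem _, zero_mem _]
  choose a ha hsupp using hrep
  refine ⟨a '' border O, (finite_border hfin).image a, ?_, O, ⟨hfin, fun β hβ α h => hlow h hβ⟩,
    fun b => specialize k K n m σ (a b), fun _ => 1,
    ⟨fun b _ => ⟨hsupp b, Ideal.mem_map_of_mem _ (ha b)⟩, hlin, hspan⟩,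
    fun _ _ => one_ne_zero, ?_⟩
  · rintro _ ⟨b, -, rfl⟩
    exact ha b
  · rw [Set.image_image]
    simp only [one_smul]

/-- For an ideal containing a nonzero constant, a scalar multiple of `1` is a scalar border basis
with respect to the empty order ideal. -/
theorem isScalarBorderBasis_empty {n : ℕ} {F : Type*} [Field F]
    {I : Ideal (MvPolynomial (Fin n) F)} {c : F} (hc : c ≠ 0) (hI : C c ∈ I) :
    IsScalarBorderBasis F ∅ I {C c} := by
  have htop : I = ⊤ := Ideal.eq_top_of_isUnit_mem _ hI ((isUnit_iff_ne_zero.mpr hc).map C)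
  subst htop
  refine ⟨fun _ => 1, fun _ => c, ⟨?_, linearIndependent_empty_type, Subsingleton.elim _ _⟩,
    fun _ _ => hc, ?_⟩
  · rintro b (⟨-, rfl⟩ | ⟨h, -⟩)
    · refine ⟨?_, Submodule.mem_top⟩
      simp [← one_def]
    · exact (h rfl).elim
  · have hb : border (∅ : Set (Fin n →₀ ℕ)) = {0} := by
      ext b
      simp [border]
    rw [hb, Set.image_singleton, smul_eq_C_mul, mul_one]

/-- for a zero-dimensional ideal `𝔞 ⊆ k[x₁,…,xₙ,u₁,…,uₘ]`, a comprehensive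
border basis for `𝔞` exists: there is a finite set `B ⊆ 𝔞` such that for every
specialization `σ ∈ k̄^m` there exists an order ideal `O ⊆ T^n` for which some subset of
`σ(B)` is a scalar `O`-border basis of `σ(𝔞)` in `k̄[x₁,…,xₙ]`. -/
theorem exists_comprehensive_border_basis
    {n m : ℕ} (k K : Type*) [Field k] [Field K] [Algebra k K] [IsAlgClosure k K]
    (𝔞 : Ideal (MvPolynomial (Fin n ⊕ Fin m) k))
    (h0 : FiniteDimensional k (MvPolynomial (Fin n ⊕ Fin m) k ⧸ 𝔞)) :
    ∃ B : Set (MvPolynomial (Fin n ⊕ Fin m) k),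
      B.Finite ∧ B ⊆ (𝔞 : Set (MvPolynomial (Fin n ⊕ Fin m) k)) ∧
      ∀ σ : Fin m → K, ∃ O : Set (Fin n →₀ ℕ), IsOrderIdeal O ∧
        ∃ B' ⊆ (specialize k K n m σ) '' B,
          IsScalarBorderBasis K O (Ideal.map (specialize k K n m σ) 𝔞) B' := by
  have : Algebra.IsAlgebraic k K := IsAlgClosure.isAlgebraic
  let u : Fin m → MvPolynomial (Fin n ⊕ Fin m) k ⧸ 𝔞 := fun j => Ideal.Quotient.mk 𝔞 (X (Sum.inr j))
  let P : Fin m → MvPolynomial (Fin n ⊕ Fin m) k := fun j => (minpoly k (u j)).aeval (X (Sum.inr j))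
  have hP : ∀ j, P j ∈ 𝔞 := fun j => by
    rw [← Ideal.Quotient.eq_zero_iff_mem, ← Ideal.Quotient.mkₐ_eq_mk k, ← Polynomial.aeval_algHom_apply]
    exact minpoly.aeval k (u j)
  have hσP : ∀ (σ : Fin m → K) j,
      specialize k K n m σ (P j) = C ((minpoly k (u j)).aeval (σ j)) := fun σ j => by
    have h : P j = rename Sum.inr ((minpoly k (u j)).aeval (X j : MvPolynomial (Fin m) k)) := by
      rw [← Polynomial.aeval_algHom_apply, rename_X]
    rw [h, specialize_rename_inr, ← Polynomial.aeval_algHom_apply, aeval_X]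
  let Z : Set (Fin m → K) := Set.univ.pi fun j => (minpoly k (u j)).rootSet K
  have hZ : Z.Finite := Set.Finite.pi fun j => Polynomial.rootSet_finite _ _
  choose B hBfin hB𝔞 hB using
    fun σ : Fin m → K => exists_finite_isScalarBorderBasis_specialize 𝔞 σ
  refine ⟨Set.range P ∪ ⋃ σ ∈ Z, B σ, (Set.finite_range P).union (hZ.biUnion fun σ _ => hBfin σ),
    Set.union_subset (Set.range_subset_iff.mpr hP) (Set.iUnion₂_subset fun σ _ => hB𝔞 σ), ?_⟩
  intro σ
  by_cases hσ : σ ∈ Z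
  · obtain ⟨O, hO, h⟩ := hB σ
    exact ⟨O, hO, _, Set.image_mono ((Set.subset_biUnion_of_mem hσ).trans
      Set.subset_union_right), h⟩
  · obtain ⟨j, hj⟩ : ∃ j, (minpoly k (u j)).aeval (σ j) ≠ 0 := by
      by_contra! h
      exact hσ fun j _ => (Polynomial.mem_rootSet_of_ne
        (minpoly.ne_zero (Algebra.IsIntegral.isIntegral (u j)))).mpr (h j)
    refine ⟨∅, ⟨Set.finite_empty, fun _ h => h.elim⟩, {C ((minpoly k (u j)).aeval (σ j))}, ?_,
      isScalarBorderBasis_empty hj ?_⟩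
    · rw [Set.singleton_subset_iff]
      exact ⟨P j, Or.inl ⟨j, rfl⟩, hσP σ j⟩
    · rw [← hσP]
      exact Ideal.mem_map_of_mem _ (hP j)
end

section
/- Let k be a field, ≤ a monomial order on the monomials of x₁,…,xₙ, and 𝔞 ⊆ k[x₁,…,xₙ] a proper zero-dimensional ideal. Let O = O_≤(𝔞) be the set of monomials not lying in the leading term ideal LT_≤(𝔞). Then the border form ideal of 𝔞 with respect to O equals the leading term ideal: BF_O(𝔞) = LT_≤(𝔞). -/
open MvPolynomial

/-- The iterated border closures: `∂̄⁰O = O` and `∂̄^{r+1}O = ∂̄(∂̄^r O) = ∂̄^r O ∪ ∂(∂̄^r O)`. -/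
def borderClosure {n : ℕ} (O : Set (Fin n →₀ ℕ)) : ℕ → Set (Fin n →₀ ℕ)
  | 0 => O
  | r + 1 => borderClosure O r ∪ border (borderClosure O r)

/-- The index `ind_O(α)`: the least `r ≥ 0` with `α ∈ ∂̄^r O`. -/
noncomputable def ind {n : ℕ} (O : Set (Fin n →₀ ℕ)) (α : Fin n →₀ ℕ) : ℕ :=
  sInf {r | α ∈ borderClosure O r}

/-- The border form `BF_O(f)`: the sum of the terms of `f` whose monomials have maximal
index among the monomials in the support of `f` (and `BF_O(0) = 0`). -/
noncomputable def borderForm {n : ℕ} {k : Type*} [Field k] (O : Set (Fin n →₀ ℕ))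
    (f : MvPolynomial (Fin n) k) : MvPolynomial (Fin n) k :=
  ∑ α ∈ f.support.filter (fun α => ind O α = f.support.sup (ind O)),
    monomial α (coeff α f)

/-- The border form ideal `BF_O(I)`, generated by the border forms of the elements of `I`. -/
noncomputable def borderFormIdeal {n : ℕ} {k : Type*} [Field k] (O : Set (Fin n →₀ ℕ))
    (I : Ideal (MvPolynomial (Fin n) k)) : Ideal (MvPolynomial (Fin n) k) :=
  Ideal.span {p | ∃ f ∈ I, p = borderForm O f}

/-- The leading monomial (exponent vector) of `f` with respect to the monomial order `m`:
the maximum, for `m`, of the support of `f` (it is `0` when `f = 0`). -/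
noncomputable def leadMonomial {n : ℕ} (m : MonomialOrder (Fin n)) {k : Type*}
    [CommSemiring k] (f : MvPolynomial (Fin n) k) : Fin n →₀ ℕ :=
  m.toSyn.symm (f.support.sup fun α => m.toSyn α)

/-- The leading term ideal `LT_≤(I)`, generated by the leading monomials of the nonzero
elements of `I`. -/
noncomputable def leadingTermIdeal {n : ℕ} (m : MonomialOrder (Fin n)) {k : Type*}
    [Field k] (I : Ideal (MvPolynomial (Fin n) k)) : Ideal (MvPolynomial (Fin n) k) :=
  Ideal.span {p | ∃ f ∈ I, f ≠ 0 ∧ p = monomial (leadMonomial m f) (1 : k)}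

/-- `O_≤(I)`: the set of monomials not belonging to the leading term ideal of `I`. -/
noncomputable def complementLT {n : ℕ} (m : MonomialOrder (Fin n)) {k : Type*}
    [Field k] (I : Ideal (MvPolynomial (Fin n) k)) : Set (Fin n →₀ ℕ) :=
  {α | (monomial α (1 : k) : MvPolynomial (Fin n) k) ∉ leadingTermIdeal m I}

theorem eq_univ_of_add_single_mem {σ : Type*} {S : Set (σ →₀ ℕ)} (h0 : 0 ∈ S)
    (hS : ∀ α ∈ S, ∀ i, α + Finsupp.single i 1 ∈ S) : S = Set.univ := by
  have key : ∀ γ : σ →₀ ℕ, ∀ α ∈ S, α + γ ∈ S := by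
    intro γ
    induction γ using Finsupp.induction_linear with
    | zero => simp
    | add f g hf hg => exact fun α hα => by simpa [add_assoc] using hg _ (hf α hα)
    | single i b =>
      induction b with
      | zero => simp
      | succ b ih =>
        intro α hα
        rw [Finsupp.single_add, ← add_assoc]
        exact hS _ (ih α hα) i
  exact Set.eq_univ_of_forall fun α => by simpa using key α 0 h0

theorem exists_mem_borderClosure {n : ℕ} {O : Set (Fin n →₀ ℕ)} (h0 : 0 ∈ O)
    (α : Fin n →₀ ℕ) : ∃ r, α ∈ borderClosure O r := by
  have h : {α | ∃ r, α ∈ borderClosure O r} = Set.univ := by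
    refine eq_univ_of_add_single_mem ⟨0, h0⟩ ?_
    rintro α ⟨r, hr⟩ i
    refine ⟨r + 1, ?_⟩
    by_cases h : α + Finsupp.single i 1 ∈ borderClosure O r
    · exact Or.inl h
    · exact Or.inr (Or.inr ⟨Set.Nonempty.ne_empty ⟨α, hr⟩, h, i, α, hr, rfl⟩)
  exact h.ge (Set.mem_univ α)

theorem ind_eq_zero_iff {n : ℕ} {O : Set (Fin n →₀ ℕ)} (h0 : 0 ∈ O) {α : Fin n →₀ ℕ} :
    ind O α = 0 ↔ α ∈ O := by
  rw [ind, Nat.sInf_eq_zero]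
  refine ⟨?_, Or.inl⟩
  rintro (h | h)
  · exact h
  · obtain ⟨r, hr⟩ := exists_mem_borderClosure h0 α
    exact (h.le hr).elim

theorem ind_eq_one_of_mem_border {n : ℕ} {O : Set (Fin n →₀ ℕ)} (h0 : 0 ∈ O)
    {β : Fin n →₀ ℕ} (hβ : β ∈ border O) : ind O β = 1 := by
  have hle : ind O β ≤ 1 := Nat.sInf_le (Or.inr hβ)
  have hne : ind O β ≠ 0 := by
    rw [Ne, ind_eq_zero_iff h0]
    rcases hβ with ⟨h, -⟩ | ⟨-, h, -⟩
    · simp [h] at h0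
    · exact h
  omega

theorem exists_mem_border_le {n : ℕ} {O : Set (Fin n →₀ ℕ)} (h0 : 0 ∈ O)
    {α : Fin n →₀ ℕ} (hα : α ∉ O) : ∃ β ∈ border O, β ≤ α := by
  have h : {α | α ∈ O ∨ ∃ β ∈ border O, β ≤ α} = Set.univ := by
    refine eq_univ_of_add_single_mem (Or.inl h0) ?_
    rintro α (hα | ⟨β, hβ, hle⟩) i
    · by_cases h : α + Finsupp.single i 1 ∈ O
      · exact Or.inl h
      · exact Or.inr ⟨_, Or.inr ⟨Set.Nonempty.ne_empty ⟨0, h0⟩, h, i, α, hα, rfl⟩, le_rfl⟩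
    · exact Or.inr ⟨β, hβ, hle.trans le_self_add⟩
  exact (h.ge (Set.mem_univ α)).resolve_left hα

theorem monomial_mem_of_le {σ k : Type*} [CommSemiring k] {J : Ideal (MvPolynomial σ k)}
    {α β : σ →₀ ℕ} (hle : β ≤ α) (hβ : monomial β (1 : k) ∈ J) (c : k) :
    monomial α c ∈ J := by
  have h := J.mul_mem_left (monomial (α - β) c) hβ
  rwa [monomial_mul, mul_one, tsub_add_cancel_of_le hle] at h

theorem mem_complementLT_iff {n : ℕ} {k : Type*} [Field k] {m : MonomialOrder (Fin n)}
    {I : Ideal (MvPolynomial (Fin n) k)} {α : Fin n →₀ ℕ} :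
    α ∈ complementLT m I ↔ ∀ f ∈ I, f ≠ 0 → ¬ m.degree f ≤ α := by
  have h : leadingTermIdeal m I =
      Ideal.span ((fun s => monomial s (1 : k)) '' {s | ∃ f ∈ I, f ≠ 0 ∧ m.degree f = s}) := by
    rw [leadingTermIdeal]
    congr 1
    ext p
    constructor
    · rintro ⟨f, hf, hf0, rfl⟩
      exact ⟨_, ⟨f, hf, hf0, rfl⟩, rfl⟩
    · rintro ⟨_, ⟨f, hf, hf0, rfl⟩, rfl⟩
      exact ⟨f, hf, hf0, rfl⟩
  rw [complementLT, Set.mem_ofPred_eq, h, mem_ideal_span_monomial_image]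
  classical
  simp only [support_monomial, one_ne_zero, if_false, Finset.mem_singleton, forall_eq,
    Set.mem_ofPred_eq]
  grind

theorem zero_mem_complementLT {n : ℕ} {k : Type*} [Field k] {m : MonomialOrder (Fin n)}
    {I : Ideal (MvPolynomial (Fin n) k)} (hproper : I ≠ ⊤) : 0 ∈ complementLT m I := by
  rw [mem_complementLT_iff]
  intro f hf hf0 hle
  have hC := m.eq_C_of_degree_eq_zero (nonpos_iff_eq_zero.mp hle)
  refine hproper (Ideal.eq_top_of_isUnit_mem I hf ?_)
  rw [hC]
  exact (IsUnit.mk0 _ (m.leadingCoeff_ne_zero_iff.mpr hf0)).map C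

theorem exists_sub_mem_support_subset_complementLT {n : ℕ} {k : Type*} [Field k]
    (m : MonomialOrder (Fin n)) (I : Ideal (MvPolynomial (Fin n) k))
    (f : MvPolynomial (Fin n) k) :
    ∃ r, f - r ∈ I ∧ ∀ α ∈ r.support, α ∈ complementLT m I := by
  obtain ⟨g, r, hfr, -, hr⟩ := m.div_set (B := {b | b ∈ I ∧ b ≠ 0})
    (fun b hb => IsUnit.mk0 _ (m.leadingCoeff_ne_zero_iff.mpr hb.2)) f
  refine ⟨r, ?_, fun α hα => mem_complementLT_iff.mpr fun b hb hb0 => hr α hα b ⟨hb, hb0⟩⟩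
  rw [hfr, add_sub_cancel_right, Finsupp.linearCombination_apply]
  exact I.sum_mem fun b _ => I.mul_mem_left _ b.2.1

theorem borderForm_sub_eq_monomial {n : ℕ} {k : Type*} [Field k] {O : Set (Fin n →₀ ℕ)}
    (h0 : 0 ∈ O) {β : Fin n →₀ ℕ} (hβ : β ∈ border O) {r : MvPolynomial (Fin n) k}
    (hr : ∀ α ∈ r.support, α ∈ O) : borderForm O (monomial β 1 - r) = monomial β 1 := by
  classical
  have hβ1 := ind_eq_one_of_mem_border h0 hβ
  have hβr : coeff β r = 0 := by
    rw [← notMem_support_iff]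
    intro h
    have := (ind_eq_zero_iff h0).mpr (hr β h)
    omega
  have hcoeff : coeff β (monomial β 1 - r) = 1 := by simp [hβr]
  have hmem : β ∈ (monomial β 1 - r).support := by simp [mem_support_iff, hβr]
  have hind : ∀ α ∈ (monomial β 1 - r).support, α ≠ β → ind O α = 0 := by
    intro α hα hne
    refine (ind_eq_zero_iff h0).mpr (hr α ?_)
    simpa [mem_support_iff, coeff_monomial, hne.symm] using hα
  have hsup : (monomial β 1 - r).support.sup (ind O) = 1 := by
    refine le_antisymm (Finset.sup_le fun α hα => ?_) (hβ1.ge.trans (Finset.le_sup hmem))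
    by_cases h : α = β
    · rw [h, hβ1]
    · simp [hind α hα h]
  rw [borderForm, hsup, Finset.sum_eq_single_of_mem β (by simp [hβ1, hβr]), hcoeff]
  intro α hα hne
  obtain ⟨hα, h1⟩ := Finset.mem_filter.mp hα
  simp [hind α hα hne] at h1

theorem borderForm_mem_leadingTermIdeal {n : ℕ} {k : Type*} [Field k]
    {m : MonomialOrder (Fin n)} {I : Ideal (MvPolynomial (Fin n) k)} (hproper : I ≠ ⊤)
    {f : MvPolynomial (Fin n) k} (hf : f ∈ I) :
    borderForm (complementLT m I) f ∈ leadingTermIdeal m I := by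
  refine Ideal.sum_mem _ fun α hα => ?_
  obtain ⟨hαf, hα⟩ := Finset.mem_filter.mp hα
  have hf0 : f ≠ 0 := by
    rintro rfl
    simp at hαf
  have hne : ind (complementLT m I) α ≠ 0 := by
    intro h
    have hdeg : ind (complementLT m I) (m.degree f) ≤ 0 := by
      rw [← h, hα]
      exact Finset.le_sup (m.degree_mem_support hf0)
    exact mem_complementLT_iff.mp
      ((ind_eq_zero_iff (zero_mem_complementLT hproper)).mp (Nat.le_zero.mp hdeg)) f hf hf0 le_rfl
  rw [Ne, ind_eq_zero_iff (zero_mem_complementLT hproper)] at hne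
  exact monomial_mem_of_le le_rfl (not_not.mp hne) _

/-- let `≤` be a monomial order, `𝔞 ⊆ k[x₁,…,xₙ]` a proper zero-dimensional
ideal, and `O = O_≤(𝔞)` the set of monomials not lying in the leading term ideal
`LT_≤(𝔞)`.  Then the border form ideal of `𝔞` with respect to `O` equals the leading
term ideal: `BF_O(𝔞) = LT_≤(𝔞)`. -/
theorem borderFormIdeal_eq_leadingTermIdeal
    {n : ℕ} (k : Type*) [Field k] (m : MonomialOrder (Fin n))
    (I : Ideal (MvPolynomial (Fin n) k)) (hproper : I ≠ ⊤)
    (h0 : FiniteDimensional k (MvPolynomial (Fin n) k ⧸ I)) :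
    borderFormIdeal (complementLT m I) I = leadingTermIdeal m I := by
  have h0 := zero_mem_complementLT (m := m) hproper
  refine le_antisymm (Ideal.span_le.mpr ?_) (Ideal.span_le.mpr ?_)
  · rintro _ ⟨f, hf, rfl⟩
    exact borderForm_mem_leadingTermIdeal hproper hf
  · rintro _ ⟨f, hf, hf0, rfl⟩
    have hdeg : leadMonomial m f ∉ complementLT m I :=
      fun h => mem_complementLT_iff.mp h f hf hf0 le_rfl
    obtain ⟨β, hβ, hle⟩ := exists_mem_border_le h0 hdeg
    obtain ⟨r, hrI, hr⟩ := exists_sub_mem_support_subset_complementLT m I (monomial β 1)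
    have hβ : monomial β (1 : k) ∈ borderFormIdeal (complementLT m I) I :=
      Ideal.subset_span ⟨_, hrI, (borderForm_sub_eq_monomial h0 hβ hr).symm⟩
    exact monomial_mem_of_le hle hβ 1
end

section
/- Let k be a field, ≤ a monomial order on the monomials of x₁,…,xₙ, and 𝔞 ⊆ k[x₁,…,xₙ] a proper zero-dimensional ideal, with O = O_≤(𝔞) the set of monomials not lying in LT_≤(𝔞). If B is the O-border basis of 𝔞, then for each element gⱼ = bⱼ − Σᵢ cᵢⱼ tᵢ of B (with border term bⱼ ∈ ∂O and tᵢ ∈ O), the leading monomial of gⱼ with respect to ≤ is its border term: LM_≤(gⱼ) = bⱼ. -/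
open MvPolynomial

theorem not_mem_of_mem_border {n : ℕ} {O : Set (Fin n →₀ ℕ)} {b : Fin n →₀ ℕ}
    (hb : b ∈ border O) : b ∉ O := by
  rcases hb with ⟨rfl, -⟩ | ⟨-, hb, -⟩
  · exact Set.notMem_empty b
  · exact hb

theorem leadMonomial_not_mem_complementLT {n : ℕ} {k : Type*} [Field k]
    (m : MonomialOrder (Fin n)) {I : Ideal (MvPolynomial (Fin n) k)}
    {f : MvPolynomial (Fin n) k} (hf : f ∈ I) (hf0 : f ≠ 0) :
    leadMonomial m f ∉ complementLT m I :=
  fun h => h (Ideal.subset_span ⟨f, hf, hf0, rfl⟩)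

theorem leadMonomial_mem_support {n : ℕ} {k : Type*} [CommSemiring k]
    (m : MonomialOrder (Fin n)) {f : MvPolynomial (Fin n) k} (hf : f ≠ 0) :
    leadMonomial m f ∈ f.support :=
  m.degree_mem_support hf

/-- let `≤` be a monomial order, `𝔞 ⊆ k[x₁,…,xₙ]` a proper
zero-dimensional ideal, and `O = O_≤(𝔞)`.  If `B = {g_b : b ∈ ∂O}` is the `O`-border
basis of `𝔞`, then for each element `g_b = b − Σᵢ cᵢ tᵢ` of `B` the leading monomial of
`g_b` with respect to `≤` is its border term: `LM_≤(g_b) = b`. -/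
theorem leadMonomial_of_border_basis_element
    {n : ℕ} (k : Type*) [Field k] (m : MonomialOrder (Fin n))
    (I : Ideal (MvPolynomial (Fin n) k)) (hproper : I ≠ ⊤)
    (h0 : FiniteDimensional k (MvPolynomial (Fin n) k ⧸ I))
    (g : (Fin n →₀ ℕ) → MvPolynomial (Fin n) k)
    (hg : IsBorderBasisFun k (complementLT m I) I g) :
    ∀ b ∈ border (complementLT m I), leadMonomial m (g b) = b := by
  intro b hb
  obtain ⟨hsupp, hmem⟩ := hg.1 b hb
  have hbO := not_mem_of_mem_border hb
  have hcoeff : coeff b (g b - monomial b 1) = 0 :=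
    notMem_support_iff.mp fun h => hbO (hsupp h)
  have hne : g b ≠ 0 := by
    intro h
    simp [h] at hcoeff
  by_contra hlead
  refine leadMonomial_not_mem_complementLT m hmem hne (hsupp ?_)
  have hcoeff_lead := mem_support_iff.mp (leadMonomial_mem_support m hne)
  rw [Finset.mem_coe, mem_support_iff, coeff_sub, coeff_monomial, if_neg (Ne.symm hlead), sub_zero]
  exact hcoeff_lead
end

section
/- Let k be a field, ≤ a monomial order on the monomials of x₁,…,xₙ, and 𝔞 ⊆ k[x₁,…,xₙ] a proper zero-dimensional ideal, with O = O_≤(𝔞) the set of monomials not lying in LT_≤(𝔞). Then the reduced Gröbner basis of 𝔞 with respect to ≤ is a subset of the O-border basis of 𝔞. -/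
open MvPolynomial

/-- `G` is a reduced Gröbner basis of `I` w.r.t. the monomial order `m`: a finite set of
monic elements of `I` whose leading monomials generate `LT_≤(I)`, such that for each
`g ∈ G` no monomial in the support of `g` other than `LM_≤(g)` lies in `LT_≤(I)`, and
`LM_≤(g)` is not divisible by `LM_≤(g')` for any other `g' ∈ G`. -/
def IsReducedGroebnerBasis {n : ℕ} {k : Type*} [Field k] (m : MonomialOrder (Fin n))
    (I : Ideal (MvPolynomial (Fin n) k)) (G : Set (MvPolynomial (Fin n) k)) : Prop :=
  G.Finite ∧ (∀ g ∈ G, g ∈ I) ∧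
  (∀ g ∈ G, coeff (leadMonomial m g) g = 1) ∧
  Ideal.span {p | ∃ g ∈ G, p = (monomial (leadMonomial m g) (1 : k) :
      MvPolynomial (Fin n) k)} = leadingTermIdeal m I ∧
  (∀ g ∈ G, ∀ α ∈ g.support, α ≠ leadMonomial m g →
    (monomial α (1 : k) : MvPolynomial (Fin n) k) ∉ leadingTermIdeal m I) ∧
  (∀ g ∈ G, ∀ g' ∈ G, g' ≠ g → ¬ leadMonomial m g' ≤ leadMonomial m g)

/-- If the monomials of `O` are linearly independent modulo `I`, then no nonzero element of `I` is
supported in `O`. -/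
theorem eq_zero_of_mem_of_support_subset {n : ℕ} {F : Type*} [Field F]
    {O : Set (Fin n →₀ ℕ)} {I : Ideal (MvPolynomial (Fin n) F)}
    (hO : LinearIndependent F
      (fun t : O => Ideal.Quotient.mk I (monomial (t : Fin n →₀ ℕ) (1 : F))))
    {f : MvPolynomial (Fin n) F} (hf : f ∈ I) (hsupp : ↑f.support ⊆ O) : f = 0 := by
  have hO' : LinearIndepOn F (fun t => Ideal.Quotient.mkₐ F I (monomial t (1 : F))) O := hO
  have hsum : ∑ t ∈ f.support, coeff t f • Ideal.Quotient.mkₐ F I (monomial t (1 : F)) = 0 := by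
    rw [← Ideal.Quotient.eq_zero_iff_mem, ← Ideal.Quotient.mkₐ_eq_mk F] at hf
    conv_rhs => rw [← hf, f.as_sum, map_sum]
    refine Finset.sum_congr rfl fun t _ => ?_
    rw [← map_smul, smul_monomial, smul_eq_mul, mul_one]
  ext t
  by_contra ht
  exact ht (linearIndepOn_iff'.1 hO' f.support (fun t => coeff t f) hsupp hsum t
    (mem_support_iff.2 ht))

/-- A monomial lies in the ideal generated by the leading monomials of `G` iff it is divisible by
one of them. -/
theorem monomial_mem_span_leadMonomial_iff {n : ℕ} {k : Type*} [Field k]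
    (m : MonomialOrder (Fin n)) (G : Set (MvPolynomial (Fin n) k)) (α : Fin n →₀ ℕ) :
    (monomial α (1 : k) : MvPolynomial (Fin n) k) ∈
        Ideal.span {p | ∃ g ∈ G, p = (monomial (leadMonomial m g) (1 : k) :
          MvPolynomial (Fin n) k)} ↔
      ∃ g ∈ G, leadMonomial m g ≤ α := by
  have h : {p | ∃ g ∈ G, p = (monomial (leadMonomial m g) (1 : k) : MvPolynomial (Fin n) k)} =
      (fun s => monomial s (1 : k)) '' (leadMonomial m '' G) := by
    ext p
    simp [eq_comm]
  rw [h, mem_ideal_span_monomial_image]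
  simp

theorem ne_empty_of_span_mk_monomial_eq_top {n : ℕ} {F : Type*} [Field F]
    {O : Set (Fin n →₀ ℕ)} {I : Ideal (MvPolynomial (Fin n) F)} (hI : I ≠ ⊤)
    (hO : Submodule.span F
      (Set.range fun t : O => Ideal.Quotient.mk I (monomial (t : Fin n →₀ ℕ) (1 : F))) = ⊤) :
    O ≠ ∅ := by
  rintro rfl
  have := Ideal.Quotient.nontrivial_iff.2 hI
  rw [Set.range_eq_empty, Submodule.span_empty] at hO
  exact bot_ne_top hO

/-- The leading monomial of an element of the reduced Gröbner basis lies in the border of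
`O_≤(I)`. -/
theorem leadMonomial_mem_border {n : ℕ} {k : Type*} [Field k] {m : MonomialOrder (Fin n)}
    {I : Ideal (MvPolynomial (Fin n) k)} {G : Set (MvPolynomial (Fin n) k)}
    (hG : IsReducedGroebnerBasis m I G) (hne : complementLT m I ≠ ∅)
    {g : MvPolynomial (Fin n) k} (hg : g ∈ G) :
    leadMonomial m g ∈ border (complementLT m I) := by
  obtain ⟨-, -, -, hspan, -, hmin⟩ := hG
  have hmem (α : Fin n →₀ ℕ) : α ∈ complementLT m I ↔ ∀ g' ∈ G, ¬ leadMonomial m g' ≤ α := by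
    rw [complementLT, Set.mem_ofPred_eq, ← hspan, monomial_mem_span_leadMonomial_iff]
    push Not
    rfl
  have h0 : leadMonomial m g ≠ 0 := by
    obtain ⟨α, hα⟩ := Set.nonempty_iff_ne_empty.2 hne
    exact fun h => (hmem α).1 hα g hg (h ▸ zero_le)
  obtain ⟨i, hi⟩ := Finsupp.ne_iff.1 h0
  have hle : Finsupp.single i 1 ≤ leadMonomial m g :=
    Finsupp.single_le_iff.2 (Nat.one_le_iff_ne_zero.2 hi)
  refine Or.inr ⟨hne, fun h => (hmem _).1 h g hg le_rfl, i,
    leadMonomial m g - Finsupp.single i 1, (hmem _).2 fun g' hg' hle' => ?_,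
    (tsub_add_cancel_of_le hle).symm⟩
  obtain rfl : g' = g := by
    by_contra hgg'
    exact hmin g hg g' hg' hgg' (hle'.trans tsub_le_self)
  have := hle' i
  rw [Finsupp.tsub_apply, Finsupp.single_eq_same] at this
  have hi' : leadMonomial m g' i ≠ 0 := hi
  omega

/-- let `≤` be a monomial order, `𝔞 ⊆ k[x₁,…,xₙ]` a proper
zero-dimensional ideal, and `O = O_≤(𝔞)`.  Then the reduced Gröbner basis of `𝔞` with
respect to `≤` is a subset of the `O`-border basis of `𝔞`. -/
theorem reduced_groebner_basis_subset_border_basis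
    {n : ℕ} (k : Type*) [Field k] (m : MonomialOrder (Fin n))
    (I : Ideal (MvPolynomial (Fin n) k)) (hproper : I ≠ ⊤)
    (h0 : FiniteDimensional k (MvPolynomial (Fin n) k ⧸ I))
    (G B : Set (MvPolynomial (Fin n) k))
    (hG : IsReducedGroebnerBasis m I G)
    (hB : IsBorderBasis k (complementLT m I) I B) :
    G ⊆ B := by
  obtain ⟨f, ⟨hf, hindep, htop⟩, rfl⟩ := hB
  intro g hg
  have hb := leadMonomial_mem_border hG (ne_empty_of_span_mk_monomial_eq_top hproper htop) hg
  obtain ⟨-, hGI, hmonic, -, htail, -⟩ := hG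
  obtain ⟨hfsupp, hfI⟩ := hf _ hb
  refine ⟨_, hb, sub_eq_zero.1 (eq_zero_of_mem_of_support_subset hindep
    (I.sub_mem hfI (hGI g hg)) fun α hα => ?_)⟩
  by_contra hαO
  refine mem_support_iff.1 hα ?_
  have hfα : coeff α (f (leadMonomial m g)) = coeff α (monomial (leadMonomial m g) (1 : k)) := by
    by_contra h
    exact hαO (hfsupp (mem_support_iff.2 (by rwa [coeff_sub, sub_ne_zero])))
  rw [coeff_sub, hfα, coeff_monomial, sub_eq_zero]
  split_ifs with h
  · rw [← h, hmonic g hg]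
  · by_contra hα'
    exact hαO (htail g hg α (mem_support_iff.2 (Ne.symm hα')) (Ne.symm h))
end
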